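/- arXiv:1701.01059 — 2 statements merged into one kernel-verified Lean document; each statement's English description precedes it below -/
import Mathlib

section
/- Let q be a prime power, m ≥ 2, and d an integer with 1 ≤ d ≤ (m−1)(q−1). Then the dimension over F_q of the homogeneous Reed–Muller code HRMC_d(m,q) equals Σ_t Σ_{j=0}^{m} (−1)^j · C(m,j) · C(t − jq + m − 1, t − jq), where the outer sum runs over all integers t with 0 < t ≤ d and t ≡ d (mod q−1), and the binomial coefficient C(t − jq + m − 1, t − jq) is taken to be 0 whenever t − jq < 0. -/
open MvPolynomial

/-- The weighted degree: total degree of `F(Y_0^{w_0}, …, Y_{m-1}^{w_{m-1}})`. -/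
noncomputable def wdeg {F : Type*} [CommSemiring F] {m : ℕ} (w : Fin m → ℕ)
    (f : MvPolynomial (Fin m) F) : ℕ :=
  ((MvPolynomial.bind₁ (fun l : Fin m => (MvPolynomial.X l : MvPolynomial (Fin m) F) ^ (w l))) f).totalDegree

/-- The weighted Reed–Muller code `WRMC_ω(m,q)` as a subspace of `F^{q^m}`. -/
noncomputable def WRMC (F : Type*) [CommSemiring F] [Fintype F] (m : ℕ) (w : Fin m → ℕ) (ω : ℕ) :
    Submodule F ((Fin m → F) → F) :=
  Submodule.span F
    {v | ∃ f : MvPolynomial (Fin m) F, wdeg w f ≤ ω ∧ v = fun P => MvPolynomial.eval P f}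

/-- The generalized Reed–Muller code `C_ω(m,q)`. -/
noncomputable def GRM (F : Type*) [CommSemiring F] [Fintype F] (m ω : ℕ) :
    Submodule F ((Fin m → F) → F) :=
  Submodule.span F
    {v | ∃ f : MvPolynomial (Fin m) F, f.totalDegree ≤ ω ∧ v = fun P => MvPolynomial.eval P f}

/-- The homogeneous Reed–Muller code `HRMC_d(m,q)`. -/
noncomputable def HRMC (F : Type*) [CommSemiring F] [Fintype F] (m d : ℕ) :
    Submodule F ((Fin m → F) → F) :=
  Submodule.span F
    {v | ∃ f : MvPolynomial (Fin m) F, f.IsHomogeneous d ∧ v = fun P => MvPolynomial.eval P f}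

/-- The ideal `(X_0^p - 1, …, X_{m-1}^p - 1)`. -/
noncomputable def Aideal (p m : ℕ) : Ideal (MvPolynomial (Fin m) (ZMod p)) :=
  Ideal.span (Set.range fun l : Fin m => (MvPolynomial.X l : MvPolynomial (Fin m) (ZMod p)) ^ p - 1)

/-- The modular algebra `A = F_p[X_0,…,X_{m-1}]/(X_0^p-1,…,X_{m-1}^p-1)`. -/
abbrev ModA (p m : ℕ) : Type := MvPolynomial (Fin m) (ZMod p) ⧸ Aideal p m

/-- `x_l`, the image of `X_l` in `A`. -/
noncomputable def xA (p m : ℕ) (l : Fin m) : ModA p m :=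
  Ideal.Quotient.mk (Aideal p m) (MvPolynomial.X l)

/-- The identification `ψ : F_p^{p^m} → A` sending `(c_j)` to `Σ_j c_j x_0^{j_0} ⋯ x_{m-1}^{j_{m-1}}`. -/
noncomputable def psi (p m : ℕ) [NeZero p] : ((Fin m → ZMod p) → ZMod p) →ₗ[ZMod p] ModA p m where
  toFun c := ∑ j : Fin m → ZMod p, c j • ∏ l, (xA p m l) ^ (j l).val
  map_add' a b := by simp [add_smul, Finset.sum_add_distrib]
  map_smul' r a := by simp [Finset.smul_sum, smul_smul]

/-- `b(η) = ∏_{l ∈ η} (x_l - 1)` in the binary algebra `A`. -/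
noncomputable def bElt (m : ℕ) (η : Finset (Fin m)) : ModA 2 m :=
  ∏ l ∈ η, (xA 2 m l - 1)

/-- The number of exponent vectors with entries below `q` and sum `t`, by inclusion–exclusion. -/
lemma card_filter_piFinset_range_sum_eq (q m t : ℕ) (hm : 0 < m) :
    ((((Fintype.piFinset fun _ : Fin m => Finset.range q).filter
        fun r => ∑ i, r i = t).card : ℕ) : ℤ) =
      ∑ j ∈ Finset.range (m + 1), (-1 : ℤ) ^ j * (m.choose j : ℤ) *
        (if j * q ≤ t then (((t - j * q + m - 1).choose (t - j * q) : ℤ)) else 0) := by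
  classical
  have hcount : (∑ i ∈ Finset.range q, (PowerSeries.X : PowerSeries ℤ) ^ i) ^ m =
      ∑ r ∈ Fintype.piFinset fun _ : Fin m => Finset.range q,
        (PowerSeries.X : PowerSeries ℤ) ^ (∑ i, r i) := by
    have h := Finset.prod_univ_sum (fun _ : Fin m => Finset.range q)
      (fun _ i => (PowerSeries.X : PowerSeries ℤ) ^ i)
    simpa [Finset.prod_pow_eq_pow_sum] using h
  have hfactor : (∑ i ∈ Finset.range q, (PowerSeries.X : PowerSeries ℤ) ^ i) ^ m =
      (1 - PowerSeries.X ^ q) ^ m * (PowerSeries.invOneSubPow ℤ m).val := by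
    have hinv : (1 - PowerSeries.X : PowerSeries ℤ) ^ m *
        (PowerSeries.invOneSubPow ℤ m).val = 1 := by
      rw [← PowerSeries.invOneSubPow_inv_eq_one_sub_pow]
      exact (PowerSeries.invOneSubPow ℤ m).inv_val
    rw [← geom_sum_mul_neg, mul_pow, mul_assoc, hinv, mul_one]
  have hbinom : (1 - PowerSeries.X ^ q : PowerSeries ℤ) ^ m =
      ∑ j ∈ Finset.range (m + 1),
        PowerSeries.C ((-1 : ℤ) ^ j * (m.choose j : ℤ)) * PowerSeries.X ^ (j * q) := by
    rw [sub_eq_neg_add, add_pow]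
    refine Finset.sum_congr rfl fun j _ => ?_
    rw [neg_pow, ← pow_mul, mul_comm q j]
    simp
    ring
  have h := congrArg (PowerSeries.coeff t) (hcount.symm.trans hfactor)
  rw [hbinom, Finset.sum_mul, map_sum, map_sum] at h
  rw [Finset.card_filter, Nat.cast_sum]
  refine Eq.trans (Finset.sum_congr rfl fun r _ => ?_)
    (h.trans (Finset.sum_congr rfl fun j _ => ?_))
  · simp [PowerSeries.coeff_X_pow, eq_comm]
  · rw [mul_assoc, PowerSeries.coeff_C_mul, PowerSeries.coeff_X_pow_mul',
      PowerSeries.invOneSubPow_val_eq_mk_sub_one_add_choose_of_pos _ _ hm, PowerSeries.coeff_mk]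
    congr 2
    have e : t - j * q + m - 1 = m - 1 + (t - j * q) := by omega
    rw [e, Nat.choose_symm_add]

/-- The evaluation vectors of distinct reduced monomials are linearly independent. -/
lemma linearIndependent_eval_reduced_monomials {F : Type*} [Field F] [Fintype F] {m : ℕ}
    (S : Finset (Fin m → ℕ)) (hS : ∀ r ∈ S, ∀ i, r i < Fintype.card F) :
    LinearIndependent F (fun r : S => fun P : Fin m → F => ∏ i, P i ^ r.1 i) := by
  classical
  rw [Fintype.linearIndependent_iff]
  intro g hg r
  let p : MvPolynomial (Fin m) F :=
    ∑ r : S, monomial (Finsupp.equivFunOnFinite.symm r.1) (g r)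
  have hcoeff : ∀ s : S, p.coeff (Finsupp.equivFunOnFinite.symm s.1) = g s := by
    intro s
    simp [p, coeff_sum, coeff_monomial]
  have hp : p = 0 := by
    refine eq_zero_of_eval_zero_at_prod_finset p (fun _ => Finset.univ) (fun i => ?_)
      (fun P _ => ?_)
    · rw [Finset.card_univ, degreeOf_lt_iff Fintype.card_pos]
      intro s hs
      obtain ⟨a, -, ha⟩ := Finset.mem_biUnion.1 (support_sum hs)
      have := Finset.mem_singleton.1 (support_monomial_subset ha)
      rw [this]
      exact hS a.1 a.2 i
    · have h := congrFun hg P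
      simpa [p, eval_monomial, Finsupp.prod_fintype] using h
  rw [← hcoeff r, hp, coeff_zero]

/-- The representative of an exponent modulo `x ^ q = x`, where `n = q - 1`. -/
def reduceExponent (n e : ℕ) : ℕ := if e = 0 then 0 else (e - 1) % n + 1

lemma reduceExponent_lt {n : ℕ} (hn : 0 < n) (e : ℕ) : reduceExponent n e < n + 1 := by
  have := Nat.mod_lt (e - 1) hn
  unfold reduceExponent
  split_ifs <;> omega

lemma exists_eq_reduceExponent_add (n e : ℕ) : ∃ k, e = reduceExponent n e + n * k := by
  unfold reduceExponent
  split_ifs with h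
  · exact ⟨0, by simp [h]⟩
  · exact ⟨(e - 1) / n, by have := Nat.mod_add_div (e - 1) n; omega⟩

lemma reduceExponent_eq_zero {n e : ℕ} : reduceExponent n e = 0 ↔ e = 0 := by
  unfold reduceExponent
  split_ifs <;> simp_all

lemma pow_add_card_sub_one_mul {F : Type*} [Field F] [Fintype F] (x : F) {e : ℕ} (he : e ≠ 0)
    (k : ℕ) : x ^ (e + (Fintype.card F - 1) * k) = x ^ e := by
  rcases eq_or_ne x 0 with rfl | hx
  · rw [zero_pow he, zero_pow (by omega)]
  · rw [pow_add, pow_mul, FiniteField.pow_card_sub_one_eq_one x hx, one_pow, mul_one]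

lemma pow_reduceExponent {F : Type*} [Field F] [Fintype F] (x : F) (e : ℕ) :
    x ^ reduceExponent (Fintype.card F - 1) e = x ^ e := by
  rcases eq_or_ne e 0 with rfl | he
  · simp [reduceExponent]
  · obtain ⟨k, hk⟩ := exists_eq_reduceExponent_add (Fintype.card F - 1) e
    conv_rhs => rw [hk]
    exact (pow_add_card_sub_one_mul x (reduceExponent_eq_zero.not.2 he) k).symm

/-- The reduced exponent vectors of the monomials spanning `HRMC_d(m,q)`. -/
def reducedExponents (q m d : ℕ) : Finset (Fin m → ℕ) :=
  ((Finset.Icc 1 d).filter fun t => (q - 1) ∣ (d - t)).biUnion fun t =>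
    (Fintype.piFinset fun _ : Fin m => Finset.range q).filter fun r => ∑ i, r i = t

lemma mem_reducedExponents {q m d : ℕ} {r : Fin m → ℕ} :
    r ∈ reducedExponents q m d ↔
      (1 ≤ ∑ i, r i ∧ ∑ i, r i ≤ d) ∧ (q - 1) ∣ (d - ∑ i, r i) ∧ ∀ i, r i < q := by
  simp only [reducedExponents, Finset.mem_biUnion, Finset.mem_filter, Finset.mem_Icc,
    Fintype.mem_piFinset, Finset.mem_range]
  constructor
  · rintro ⟨t, ⟨h1, h2⟩, h3, rfl⟩
    exact ⟨h1, h2, h3⟩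
  · rintro ⟨h1, h2, h3⟩
    exact ⟨_, ⟨h1, h2⟩, h3, rfl⟩

lemma card_reducedExponents (q m d : ℕ) :
    (reducedExponents q m d).card =
      ∑ t ∈ (Finset.Icc 1 d).filter fun t => (q - 1) ∣ (d - t),
        ((Fintype.piFinset fun _ : Fin m => Finset.range q).filter
          fun r => ∑ i, r i = t).card := by
  refine Finset.card_biUnion fun s _ t _ hst => Finset.disjoint_left.2 fun r hr hr' => hst ?_
  exact (Finset.mem_filter.1 hr).2.symm.trans (Finset.mem_filter.1 hr').2

lemma reduceExponent_comp_mem_reducedExponents {q m d : ℕ} (hq : 1 < q) (hd : 1 ≤ d)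
    {s : Fin m → ℕ} (hs : ∑ i, s i = d) :
    (fun i => reduceExponent (q - 1) (s i)) ∈ reducedExponents q m d := by
  choose k hk using fun i => exists_eq_reduceExponent_add (q - 1) (s i)
  have hsum : d = ∑ i, reduceExponent (q - 1) (s i) + (q - 1) * ∑ i, k i := by
    rw [Finset.mul_sum, ← Finset.sum_add_distrib, ← hs]
    exact Finset.sum_congr rfl fun i _ => hk i
  refine mem_reducedExponents.2 ⟨⟨?_, by omega⟩, ⟨∑ i, k i, by omega⟩, fun i => ?_⟩
  · by_contra h
    have h0 : ∑ i, reduceExponent (q - 1) (s i) = 0 := by omega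
    have h1 : ∑ i, s i = 0 := Finset.sum_eq_zero fun i hi =>
      reduceExponent_eq_zero.1 (Finset.sum_eq_zero_iff.1 h0 i hi)
    omega
  · have := reduceExponent_lt (n := q - 1) (by omega) (s i)
    omega

lemma HRMC_eq_span_reducedExponents (m d : ℕ) (F : Type*) [Field F] [Fintype F] (hd : 1 ≤ d) :
    HRMC F m d = Submodule.span F (Set.range
      fun r : reducedExponents (Fintype.card F) m d => fun P : Fin m → F => ∏ i, P i ^ r.1 i) := by
  classical
  apply le_antisymm
  · refine Submodule.span_le.2 ?_
    rintro _ ⟨f, hf, rfl⟩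
    have hexp : (fun P => eval P f) =
        ∑ s ∈ f.support, f.coeff s • fun P : Fin m → F => ∏ i, P i ^ s i := by
      ext P
      simp [eval_eq']
    rw [SetLike.mem_coe, hexp]
    refine Submodule.sum_mem _ fun s hs => Submodule.smul_mem _ _ (Submodule.subset_span ?_)
    have hdeg : ∑ i, s i = d := by
      rw [← Finsupp.degree_eq_sum, Finsupp.degree_eq_weight_one]
      exact hf (mem_support_iff.1 hs)
    refine ⟨⟨_, reduceExponent_comp_mem_reducedExponents Fintype.one_lt_card hd hdeg⟩, ?_⟩
    ext P
    exact Finset.prod_congr rfl fun i _ => pow_reduceExponent (P i) (s i)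
  · refine Submodule.span_mono ?_
    rintro _ ⟨⟨r, hr⟩, rfl⟩
    obtain ⟨⟨h1, h2⟩, ⟨k, hk⟩, -⟩ := mem_reducedExponents.1 hr
    obtain ⟨i₀, -, hi₀⟩ := Finset.exists_ne_zero_of_sum_ne_zero (Nat.one_le_iff_ne_zero.1 h1)
    let s : Fin m → ℕ := r + Pi.single i₀ ((Fintype.card F - 1) * k)
    refine ⟨monomial (Finsupp.equivFunOnFinite.symm s) 1, isHomogeneous_monomial _ ?_, ?_⟩
    · rw [Finsupp.degree_eq_sum]
      simp [s, Finset.sum_add_distrib]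
      omega
    · ext P
      rw [eval_monomial, one_mul, Finsupp.prod_fintype _ _ (by simp)]
      refine Finset.prod_congr rfl fun i _ => ?_
      rcases eq_or_ne i i₀ with rfl | hi
      · simpa [s] using (pow_add_card_sub_one_mul (P i) hi₀ k).symm
      · simp [s, hi]

/-- dimension of the homogeneous Reed–Muller code. The binomial coefficient
`C(t-jq+m-1, t-jq)` is taken to be `0` when `t - jq < 0`. -/
theorem hrmc_dimension (q m d : ℕ) (F : Type*) [Field F] [Fintype F]
    (hq : Fintype.card F = q) (hm : 2 ≤ m) (hd1 : 1 ≤ d) (hd2 : d ≤ (m - 1) * (q - 1)) :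
    (Module.finrank F (HRMC F m d) : ℤ) =
      ∑ t ∈ (Finset.Icc 1 d).filter (fun t => (q - 1) ∣ (d - t)),
        ∑ j ∈ Finset.range (m + 1),
          (-1 : ℤ) ^ j * (m.choose j : ℤ) *
            (if j * q ≤ t then (((t - j * q + m - 1).choose (t - j * q) : ℤ)) else 0) := by
  have hlin := linearIndependent_eval_reduced_monomials (F := F)
    (reducedExponents (Fintype.card F) m d) fun r hr => (mem_reducedExponents.1 hr).2.2
  rw [HRMC_eq_span_reducedExponents m d F hd1, finrank_span_eq_card hlin, Fintype.card_coe, hq,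
    card_reducedExponents, Nat.cast_sum]
  exact Finset.sum_congr rfl fun t _ => card_filter_piFinset_range_sum_eq q m t (by omega)
end

section
/- Let q be a prime power, m ≥ 2, and d an integer with 1 ≤ d ≤ (m−1)(q−1). Write d − 1 = r(q−1) + s with integers r ≥ 0 and 0 ≤ s < q−1. Then the minimum Hamming weight of a nonzero codeword of the homogeneous Reed–Muller code HRMC_d(m,q) equals (q−1)(q−s)·q^{m−r−2}. -/
open MvPolynomial

section

variable {F : Type*} [Field F]

lemma totalDegree_bind₁_le_of_totalDegree_le_one {σ τ : Type*}
    {u : σ → MvPolynomial τ F} (hu : ∀ i, (u i).totalDegree ≤ 1) (f : MvPolynomial σ F) :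
    (bind₁ u f).totalDegree ≤ f.totalDegree := by
  conv_lhs => rw [f.as_sum, map_sum]
  refine totalDegree_finsetSum_le fun v hv => ?_
  rw [bind₁_monomial]
  refine (totalDegree_mul _ _).trans ?_
  rw [totalDegree_C, zero_add]
  refine (totalDegree_finsetProd _ _).trans (le_trans ?_ (le_totalDegree hv))
  refine Finset.sum_le_sum fun i _ => (totalDegree_pow _ _).trans ?_
  exact (Nat.mul_le_mul_left _ (hu i)).trans_eq (mul_one _)

lemma dvd_sub_bind₁ {σ : Type*} {u : σ → MvPolynomial σ F} {l : MvPolynomial σ F}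
    (hl : ∀ i, l ∣ X i - u i) (f : MvPolynomial σ F) : l ∣ f - bind₁ u f := by
  induction f using MvPolynomial.induction_on with
  | C a => simp
  | add p q hp hq =>
    rw [map_add, add_sub_add_comm]
    exact dvd_add hp hq
  | mul_X p i hp =>
    have : p * X i - bind₁ u (p * X i) =
        (p - bind₁ u p) * X i + bind₁ u p * (X i - u i) := by
      rw [map_mul, bind₁_X_right]; ring
    rw [this]
    exact dvd_add (hp.mul_right _) ((hl i).mul_left _)

/-- A polynomial function which is nonzero but vanishes on the hyperplane onto which `u` projects
is the product of the equation `l` of that hyperplane and a polynomial of smaller degree. -/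
lemma exists_eval_eq_mul_of_eval_bind₁_eq_zero {σ : Type*} {u : σ → MvPolynomial σ F}
    {l : MvPolynomial σ F} (hl : ∀ i, l ∣ X i - u i) (hu : ∀ i, (u i).totalDegree ≤ 1)
    (hl1 : 1 ≤ l.totalDegree) (f : MvPolynomial σ F) (hf : ∃ x, eval x f ≠ 0)
    (h0 : ∀ x, eval x (bind₁ u f) = 0) :
    ∃ g : MvPolynomial σ F, g.totalDegree + 1 ≤ f.totalDegree ∧
      ∀ x, eval x f = eval x l * eval x g := by
  obtain ⟨g, hg⟩ := dvd_sub_bind₁ hl f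
  have hev : ∀ x, eval x f = eval x l * eval x g := fun x => by
    rw [← eval_mul, ← hg, eval_sub, h0, sub_zero]
  refine ⟨g, ?_, hev⟩
  obtain ⟨x, hx⟩ := hf
  rw [hev] at hx
  have hl0 : l ≠ 0 := by rintro rfl; simp at hx
  have hg0 : g ≠ 0 := by rintro rfl; simp at hx
  have h1 : (l * g).totalDegree = l.totalDegree + g.totalDegree :=
    totalDegree_mul_of_isDomain hl0 hg0
  have h2 := totalDegree_sub f (bind₁ u f)
  rw [hg, h1, max_eq_left (totalDegree_bind₁_le_of_totalDegree_le_one hu f)] at h2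
  omega

lemma exists_eval_eq_prod_mul {n : ℕ} (S : Finset F) (f : MvPolynomial (Fin (n + 1)) F)
    (hf : ∃ x, eval x f ≠ 0) (h0 : ∀ c ∈ S, ∀ x : Fin n → F, eval (Fin.cons c x) f = 0) :
    ∃ g : MvPolynomial (Fin (n + 1)) F, g.totalDegree + S.card ≤ f.totalDegree ∧
      ∀ x, eval x f = (∏ c ∈ S, (x 0 - c)) * eval x g := by
  classical
  induction S using Finset.induction_on with
  | empty => exact ⟨f, by simp, by simp⟩
  | insert c S hc ih =>
    obtain ⟨g, hgd, hg⟩ := ih fun c hc => h0 c (Finset.mem_insert_of_mem hc)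
    have hg0 : ∃ x, eval x g ≠ 0 := by
      obtain ⟨x, hx⟩ := hf
      exact ⟨x, fun h => hx (by rw [hg, h, mul_zero])⟩
    obtain ⟨g', hgd', hg'⟩ := exists_eval_eq_mul_of_eval_bind₁_eq_zero
      (u := Fin.cons (C c) fun i => X i.succ) (l := X 0 - C c) (f := g)
      (fun i => by refine Fin.cases ?_ (fun j => ?_) i <;> simp)
      (fun i => by refine Fin.cases ?_ (fun j => ?_) i <;> simp)
      (by
        have h := totalDegree_add (X 0 - C c : MvPolynomial (Fin (n + 1)) F) (C c)
        rw [sub_add_cancel, totalDegree_X, totalDegree_C] at h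
        simpa using h)
      hg0 (fun x => by
        have h := h0 c (Finset.mem_insert_self _ _) (fun i => x i.succ)
        rw [hg] at h
        have h1 : eval x (bind₁ (Fin.cons (C c) fun i => X i.succ) g) =
            eval (Fin.cons c fun i => x i.succ) g := by
          rw [eval, eval₂Hom_bind₁]
          congr 2
          funext i
          refine Fin.cases ?_ (fun j => ?_) i <;> simp
        rw [h1]
        refine (mul_eq_zero.mp h).resolve_left ?_
        refine Finset.prod_ne_zero_iff.mpr fun b hb => ?_
        rw [Fin.cons_zero, sub_ne_zero]
        rintro rfl
        exact hc hb)
    refine ⟨g', ?_, fun x => ?_⟩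
    · rw [Finset.card_insert_of_notMem hc]; omega
    · rw [hg, hg', Finset.prod_insert hc]; simp; ring

lemma affine_card_bound {q k s : ℕ} (hk : k < q) (hks : s < k) :
    q - s ≤ (q - k) * (q - (s + (q - 1) - k)) := by
  obtain ⟨b, rfl⟩ := Nat.exists_eq_add_of_lt hks
  obtain ⟨a, rfl⟩ := Nat.exists_eq_add_of_lt hk
  have e1 : s + b + 1 + a + 1 - (s + b + 1) = a + 1 := by omega
  have e2 : s + b + 1 + a + 1 - (s + (s + b + 1 + a + 1 - 1) - (s + b + 1)) = b + 2 := by omega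
  rw [e1, e2]
  have : s + b + 1 + a + 1 - s = a + b + 2 := by omega
  rw [this]
  nlinarith [Nat.zero_le (a * b)]

lemma affine_card_bound' {q k s : ℕ} (hk : k ≤ s) (hs : s ≤ q) :
    q * (q - s) ≤ (q - k) * (q - (s - k)) := by
  obtain ⟨a, rfl⟩ := Nat.exists_eq_add_of_le hk
  obtain ⟨b, rfl⟩ := Nat.exists_eq_add_of_le hs
  have e1 : k + a + b - k = a + b := by omega
  have e2 : k + a + b - (k + a - k) = k + b := by omega
  have e3 : k + a + b - (k + a) = b := by omega
  rw [e1, e2, e3]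
  nlinarith [Nat.zero_le (a * k)]

/-- The minimum distance bound for generalized Reed–Muller codes. -/
theorem card_eval_ne_zero_ge [Fintype F] [DecidableEq F] (n : ℕ) :
    ∀ (r s : ℕ) (f : MvPolynomial (Fin n) F), r < n → s ≤ Fintype.card F - 1 →
      f.totalDegree ≤ r * (Fintype.card F - 1) + s → (∃ x, eval x f ≠ 0) →
      (Fintype.card F - s) * Fintype.card F ^ (n - r - 1) ≤
        (Finset.univ.filter fun x => eval x f ≠ 0).card := by
  induction n with
  | zero => intro r s f hr; omega
  | succ n ih =>
    intro r s f hr hs hd hf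
    set q := Fintype.card F with hq
    have hq1 : 1 ≤ q := Fintype.card_pos
    set S : Finset F := Finset.univ.filter fun c => ∀ x : Fin n → F, eval (Fin.cons c x) f = 0
      with hS
    obtain ⟨g, hgd, hg⟩ := exists_eval_eq_prod_mul S f hf
      (fun c hc => (Finset.mem_filter.mp hc).2)
    have hk : S.card < q := by
      rw [hq]
      refine Finset.card_lt_univ_of_notMem (x := hf.choose 0) fun h => ?_
      have := (Finset.mem_filter.mp h).2 (Fin.tail hf.choose)
      rw [Fin.cons_self_tail] at this
      exact hf.choose_spec this
    have hsum : ∀ M, (∀ c ∉ S, M ≤ (Finset.univ.filter fun x : Fin n → F =>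
        eval (Fin.cons c x) g ≠ 0).card) →
        (q - S.card) * M ≤ (Finset.univ.filter fun x => eval x f ≠ 0).card := by
      intro M hM
      rw [Finset.card_eq_sum_card_fiberwise (f := fun x : Fin (n + 1) → F => x 0)
        (t := Finset.univ) (fun _ _ => by simp), hq, ← Finset.card_compl, ← smul_eq_mul]
      refine le_trans (Finset.card_nsmul_le_sum Sᶜ _ M fun c hc => ?_)
        (Finset.sum_le_sum_of_subset (Finset.subset_univ _))
      rw [Finset.mem_compl] at hc
      refine (hM c hc).trans (Finset.card_le_card_of_injOn (fun x => (Fin.cons c x : Fin (n + 1) → F)) ?_ ?_)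
      · intro x hx
        have hx' : eval (Fin.cons c x : Fin (n + 1) → F) g ≠ 0 := by simpa using hx
        have : ∏ b ∈ S, (c - b) ≠ 0 := Finset.prod_ne_zero_iff.mpr fun b hb => by
          rw [sub_ne_zero]; rintro rfl; exact hc hb
        simp [hg, this, hx']
      · exact (Fin.cons_right_injective (α := fun _ => F) c).injOn
    have hslice : ∀ c ∉ S, ∃ g' : MvPolynomial (Fin n) F, g'.totalDegree ≤ g.totalDegree ∧
        (∃ x, eval x g' ≠ 0) ∧ ∀ x, eval (Fin.cons c x) g = eval x g' := by
      intro c hc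
      have hev : ∀ x : Fin n → F, eval (Fin.cons c x) g = eval x (bind₁ (Fin.cons (C c) X) g) := by
        intro x
        rw [eval, eval, eval₂Hom_bind₁]
        congr 2
        funext i
        refine Fin.cases ?_ (fun j => ?_) i <;> simp
      refine ⟨_, totalDegree_bind₁_le_of_totalDegree_le_one (fun i => ?_) g, ?_, hev⟩
      · refine Fin.cases ?_ (fun j => ?_) i <;> simp
      · simp only [hS, Finset.mem_filter, Finset.mem_univ, true_and, not_forall] at hc
        obtain ⟨x, hx⟩ := hc
        refine ⟨x, fun h => hx ?_⟩
        rw [hg, hev, h, mul_zero]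
    by_cases hks : S.card ≤ s
    · rcases Nat.lt_or_ge r n with hrn | hrn
      · refine le_trans ?_ (hsum ((q - (s - S.card)) * q ^ (n - r - 1)) ?_)
        · rw [← mul_assoc, show n + 1 - r - 1 = (n - r - 1) + 1 by omega, pow_succ, ← mul_assoc,
            mul_right_comm, mul_comm _ q]
          exact Nat.mul_le_mul_right _ (affine_card_bound' hks (by omega))
        · intro c hc
          obtain ⟨g', hg'd, hg'0, hg'⟩ := hslice c hc
          simp only [hg']
          exact ih r (s - S.card) g' hrn (by omega) (by omega) hg'0
      · refine le_trans ?_ (hsum 1 ?_)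
        · rw [show n + 1 - r - 1 = 0 by omega, pow_zero, mul_one, mul_one]
          omega
        · intro c hc
          obtain ⟨g', -, ⟨x, hx⟩, hg'⟩ := hslice c hc
          exact Finset.card_pos.mpr ⟨x, by simp [hg', hx]⟩
    · push Not at hks
      have hr1 : 1 ≤ r := by
        rcases Nat.eq_zero_or_pos r with rfl | h
        · omega
        · exact h
      obtain ⟨r, rfl⟩ := Nat.exists_eq_add_of_le' hr1
      refine le_trans ?_ (hsum ((q - (s + (q - 1) - S.card)) * q ^ (n - r - 1)) ?_)
      · rw [← mul_assoc, show n + 1 - (r + 1) - 1 = n - r - 1 by omega]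
        exact Nat.mul_le_mul_right _ (affine_card_bound hk hks)
      · intro c hc
        obtain ⟨g', hg'd, hg'0, hg'⟩ := hslice c hc
        simp only [hg']
        refine ih r (s + (q - 1) - S.card) g' (by omega) (by omega) ?_ hg'0
        rw [add_mul] at hd
        omega

lemma eval_smul_of_isHomogeneous {σ : Type*} {d : ℕ} {f : MvPolynomial σ F}
    (hf : f.IsHomogeneous d) (t : F) (x : σ → F) : eval (t • x) f = t ^ d * eval x f := by
  rw [eval_eq, eval_eq, Finset.mul_sum]
  refine Finset.sum_congr rfl fun v hv => ?_
  have hd : ∑ i ∈ v.support, v i = d := (hf.degree_eq_sum_deg_support hv).symm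
  simp only [Pi.smul_apply, smul_eq_mul, mul_pow, Finset.prod_mul_distrib,
    Finset.prod_pow_eq_pow_sum, hd]
  ring

lemma exists_linearMap_range_eq_hyperplane {n : ℕ} (a : Fin (n + 1) → F) (ha : a ≠ 0) :
    ∃ K : (Fin n → F) →ₗ[F] (Fin (n + 1) → F), Function.Injective K ∧
      ∀ x, a ⬝ᵥ x = 0 ↔ ∃ y, K y = x := by
  let φ : Module.Dual F (Fin (n + 1) → F) :=
    { toFun := fun x => a ⬝ᵥ x
      map_add' := dotProduct_add a
      map_smul' := fun c x => dotProduct_smul c a x }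
  have hφ : φ ≠ 0 := fun h => ha (by
    funext i
    have := LinearMap.congr_fun h (Pi.single i 1)
    simpa [φ] using this)
  have h1 := Module.Dual.finrank_ker_add_one_of_ne_zero hφ
  rw [Module.finrank_fin_fun] at h1
  let e : (Fin n → F) ≃ₗ[F] LinearMap.ker φ :=
    LinearEquiv.ofFinrankEq _ _ (by rw [Module.finrank_fin_fun]; omega)
  refine ⟨(LinearMap.ker φ).subtype ∘ₗ e.toLinearMap,
    Subtype.val_injective.comp e.injective, fun x => ⟨fun hx => ?_, ?_⟩⟩
  · exact ⟨e.symm ⟨x, hx⟩, by simp⟩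
  · rintro ⟨y, rfl⟩
    exact (e y).2

lemma card_hyperplane [Fintype F] [DecidableEq F] {n : ℕ} (a : Fin (n + 1) → F) (ha : a ≠ 0) :
    (Finset.univ.filter fun x => a ⬝ᵥ x = 0).card = Fintype.card F ^ n := by
  obtain ⟨K, hK, hKr⟩ := exists_linearMap_range_eq_hyperplane a ha
  have : (Finset.univ.filter fun x => a ⬝ᵥ x = 0) = Finset.univ.image K := by
    ext x; simp [hKr]
  rw [this, Finset.card_image_of_injective _ hK]
  simp

lemma eval_bind₁_linear {n k : ℕ} (K : (Fin n → F) →ₗ[F] (Fin k → F)) (v : Fin k → F)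
    (f : MvPolynomial (Fin k) F) (y : Fin n → F) :
    eval y (bind₁ (fun i => ∑ j, C (K (fun l => if j = l then 1 else 0) i) * X j + C (v i)) f) =
      eval (K y + v) f := by
  rw [eval, eval₂Hom_bind₁]
  congr 2
  funext i
  rw [LinearMap.pi_apply_eq_sum_univ K y]
  simp [mul_comm]

lemma isHomogeneous_linear {σ : Type*} [Fintype σ] (c : σ → F) :
    (∑ j, C (c j) * X j : MvPolynomial σ F).IsHomogeneous 1 :=
  IsHomogeneous.sum _ _ _ fun j _ => isHomogeneous_C_mul_X (c j) j

lemma totalDegree_linear_add_C_le {σ : Type*} [Fintype σ] (c : σ → F) (b : F) :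
    (∑ j, C (c j) * X j + C b : MvPolynomial σ F).totalDegree ≤ 1 := by
  refine (totalDegree_add _ _).trans ?_
  rw [totalDegree_C]
  exact max_le (isHomogeneous_linear c).totalDegree_le zero_le_one

/-- A form vanishing on a hyperplane has the weight of an affine polynomial of smaller degree,
repeated on each of the nonzero translates of that hyperplane. -/
lemma card_eval_ne_zero_ge_of_vanish_on_hyperplane [Fintype F] [DecidableEq F] {n d r s : ℕ}
    {f : MvPolynomial (Fin (n + 1)) F} (hf : f.IsHomogeneous d) (hf0 : ∃ x, eval x f ≠ 0)
    (hr : r < n) (hs : s ≤ Fintype.card F - 1) (hd : d ≤ r * (Fintype.card F - 1) + s + 1)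
    {a : Fin (n + 1) → F} (ha : a ≠ 0) (h0 : ∀ x, a ⬝ᵥ x = 0 → eval x f = 0) :
    (Fintype.card F - 1) * ((Fintype.card F - s) * Fintype.card F ^ (n - r - 1)) ≤
      (Finset.univ.filter fun x => eval x f ≠ 0).card := by
  obtain ⟨i, hi⟩ : ∃ i, a i ≠ 0 := by
    by_contra! h
    exact ha (funext h)
  obtain ⟨v, hv⟩ : ∃ v, a ⬝ᵥ v = 1 := ⟨Pi.single i (a i)⁻¹, by simp [hi]⟩
  obtain ⟨K, hK, hKr⟩ := exists_linearMap_range_eq_hyperplane a ha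
  have hlev : ∀ x, eval x (∑ j, C (a j) * X j : MvPolynomial (Fin (n + 1)) F) = a ⬝ᵥ x := by
    intro x; simp [dotProduct]
  set l : MvPolynomial (Fin (n + 1)) F := ∑ j, C (a j) * X j with hl
  have hl1 : l.totalDegree = 1 := (isHomogeneous_linear a).totalDegree (by
    intro h
    have := hlev v
    rw [hl, h, hv] at this
    simp at this)
  obtain ⟨g, hgd, hg⟩ := exists_eval_eq_mul_of_eval_bind₁_eq_zero
    (u := fun j => X j - l * C (v j)) (l := l) (f := f) (fun j => by simp)
    (fun j => (totalDegree_sub _ _).trans (max_le (by simp)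
      ((totalDegree_mul _ _).trans (by simp [hl1])))) hl1.ge hf0 (fun x => by
      have h1 : eval x (bind₁ (fun j => X j - l * C (v j)) f) =
          eval (x - (a ⬝ᵥ x) • v) f := by
        rw [eval, eval₂Hom_bind₁]
        congr 2
        funext j
        change eval x (X j - l * C (v j)) = _
        simp [hlev]
      rw [h1]
      exact h0 _ (by simp [dotProduct_sub, dotProduct_smul, hv]))
  have hfd : f.totalDegree ≤ d := hf.totalDegree_le
  have haK : ∀ y, a ⬝ᵥ K y = 0 := fun y => (hKr _).mpr ⟨y, rfl⟩
  have hgK : ∀ y, eval (K y + v) f = eval (K y + v) g := by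
    intro y
    rw [hg, hlev, dotProduct_add, hv, haK, zero_add, one_mul]
  set g' := bind₁ (fun i => ∑ j, C (K (fun l => if j = l then 1 else 0) i) * X j + C (v i)) g
    with hg'
  have hg'K : ∀ y, eval y g' = eval (K y + v) f := by
    intro y
    rw [hgK, hg', eval_bind₁_linear]
  have hg'd : g'.totalDegree ≤ r * (Fintype.card F - 1) + s := by
    refine (totalDegree_bind₁_le_of_totalDegree_le_one
      (fun i => totalDegree_linear_add_C_le _ _) g).trans ?_
    omega
  have hg'0 : ∃ y, eval y g' ≠ 0 := by
    obtain ⟨x, hx⟩ := hf0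
    have hax : a ⬝ᵥ x ≠ 0 := fun h => hx (h0 x h)
    obtain ⟨y, hy⟩ := (hKr ((a ⬝ᵥ x)⁻¹ • x - v)).mp (by
      simp [dotProduct_sub, dotProduct_smul, hv, hax])
    refine ⟨y, ?_⟩
    rw [hg'K, hy, sub_add_cancel, eval_smul_of_isHomogeneous hf]
    exact mul_ne_zero (pow_ne_zero _ (inv_ne_zero hax)) hx
  have hW := card_eval_ne_zero_ge n r s g' hr hs hg'd hg'0
  refine (Nat.mul_le_mul_left _ hW).trans ?_
  have hcard : (Finset.univ.filter fun t : F => t ≠ 0).card = Fintype.card F - 1 := by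
    rw [Finset.filter_ne', Finset.card_erase_of_mem (Finset.mem_univ _), Finset.card_univ]
  rw [← hcard, ← Finset.card_product]
  refine Finset.card_le_card_of_injOn (fun p => p.1 • (K p.2 + v)) ?_ ?_
  · rintro ⟨t, y⟩ h
    simp only [Finset.coe_product, Set.mem_prod, Finset.mem_coe, Finset.mem_filter,
      Finset.mem_univ, true_and, hg'K] at h
    simp only [Finset.mem_coe, Finset.mem_filter, Finset.mem_univ, true_and]
    rw [eval_smul_of_isHomogeneous hf]
    exact mul_ne_zero (pow_ne_zero _ h.1) h.2
  · rintro ⟨t, y⟩ h ⟨t', y'⟩ - he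
    simp only [Finset.coe_product, Set.mem_prod, Finset.mem_coe, Finset.mem_filter,
      Finset.mem_univ, true_and] at h he
    have ht : t = t' := by
      have := congrArg (a ⬝ᵥ ·) he
      simpa [dotProduct_smul, dotProduct_add, hv, haK] using this
    subst ht
    have := hK (add_right_cancel (smul_right_injective _ h.1 he))
    rw [this]

lemma card_sub_one_le_of_isHomogeneous [Fintype F] [DecidableEq F] {σ : Type*} [Fintype σ]
    [DecidableEq σ] {d : ℕ} {f : MvPolynomial σ F} (hf : f.IsHomogeneous d) (hd : 1 ≤ d)
    (hf0 : ∃ x, eval x f ≠ 0) :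
    Fintype.card F - 1 ≤ (Finset.univ.filter fun x => eval x f ≠ 0).card := by
  obtain ⟨x, hx⟩ := hf0
  have hx0 : x ≠ 0 := by
    rintro rfl
    have := eval_smul_of_isHomogeneous hf 0 0
    rw [smul_zero, zero_pow (by omega), zero_mul] at this
    exact hx this
  have hcard : (Finset.univ.filter fun t : F => t ≠ 0).card = Fintype.card F - 1 := by
    rw [Finset.filter_ne', Finset.card_erase_of_mem (Finset.mem_univ _), Finset.card_univ]
  rw [← hcard]
  refine Finset.card_le_card_of_injOn (fun t => t • x) ?_ (smul_left_injective F hx0).injOn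
  intro t ht
  have ht' : t ≠ 0 := by simpa using ht
  simp [eval_smul_of_isHomogeneous hf, ht', hx]

/-- Averaging over hyperplanes. -/
lemma card_mul_le_of_forall_hyperplane [Fintype F] [DecidableEq F] {n w : ℕ} (hn : 1 ≤ n)
    (S : Finset (Fin (n + 1) → F)) (h0 : 0 ∉ S)
    (hw : ∀ a : Fin (n + 1) → F, a ≠ 0 → w ≤ (S.filter fun x => a ⬝ᵥ x = 0).card) :
    Fintype.card F * w ≤ S.card := by
  set q := Fintype.card F with hq
  have hq1 : 1 < q := Fintype.one_lt_card
  have hdc := Finset.sum_card_bipartiteAbove_eq_sum_card_bipartiteBelow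
    (s := (Finset.univ : Finset (Fin (n + 1) → F))) (t := S) (fun a x => a ⬝ᵥ x = 0)
  have hR : ∑ x ∈ S, (Finset.univ.bipartiteBelow (fun a x => a ⬝ᵥ x = 0) x).card =
      S.card * q ^ n := by
    rw [Finset.sum_const_nat]
    intro x hx
    rw [hq, ← card_hyperplane x (by rintro rfl; exact h0 hx)]
    simp only [Finset.bipartiteBelow, dotProduct_comm]
  rw [hR, ← Finset.add_sum_erase _ _ (Finset.mem_univ 0)] at hdc
  have hz : (S.bipartiteAbove (fun a x => a ⬝ᵥ x = 0) (0 : Fin (n + 1) → F)).card = S.card := by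
    simp [Finset.bipartiteAbove]
  rw [hz] at hdc
  have hL := Finset.card_nsmul_le_sum (Finset.univ.erase (0 : Fin (n + 1) → F))
    (fun a => (S.bipartiteAbove (fun a x => a ⬝ᵥ x = 0) a).card) w
    (fun a ha => hw a (Finset.ne_of_mem_erase ha))
  rw [Finset.card_erase_of_mem (Finset.mem_univ _), Finset.card_univ, Fintype.card_fun,
    Fintype.card_fin, ← hq, smul_eq_mul] at hL
  have hqn : 1 < q ^ n := Nat.one_lt_pow (by omega) hq1
  obtain ⟨Q, hQ⟩ := Nat.exists_eq_add_of_lt hqn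
  rw [pow_succ, hQ] at hL
  rw [hQ] at hdc
  obtain ⟨p, hp⟩ := Nat.exists_eq_add_of_lt hq1
  have e : (1 + Q + 1) * q - 1 = (Q + 1) * q + p + 1 := by
    rw [hp]; ring_nf; omega
  rw [e] at hL
  by_contra! hlt
  have h2 : (S.card + 1) * (Q + 1) ≤ q * w * (Q + 1) := Nat.mul_le_mul_right _ hlt
  nlinarith [Nat.zero_le (p * w), Nat.zero_le w]

/-- The minimum distance bound for homogeneous Reed–Muller codes. -/
theorem card_eval_ne_zero_ge_of_isHomogeneous [Fintype F] [DecidableEq F] {d r s : ℕ}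
    (hd1 : 1 ≤ d) (hs : s ≤ Fintype.card F - 1) (hd : d ≤ r * (Fintype.card F - 1) + s + 1)
    (n : ℕ) : ∀ f : MvPolynomial (Fin n) F, r + 2 ≤ n → f.IsHomogeneous d →
      (∃ x, eval x f ≠ 0) →
      (Fintype.card F - 1) * (Fintype.card F - s) * Fintype.card F ^ (n - r - 2) ≤
        (Finset.univ.filter fun x => eval x f ≠ 0).card := by
  induction n with
  | zero => intro f hr; omega
  | succ n ih =>
    intro f hr hf hf0
    by_cases h : ∃ a : Fin (n + 1) → F, a ≠ 0 ∧ ∀ x, a ⬝ᵥ x = 0 → eval x f = 0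
    · obtain ⟨a, ha, h0⟩ := h
      have := card_eval_ne_zero_ge_of_vanish_on_hyperplane hf hf0 (by omega : r < n) hs hd ha h0
      rwa [← mul_assoc, show n - r - 1 = n + 1 - r - 2 by omega] at this
    · push Not at h
      have hrestrict : ∀ w, (∀ g : MvPolynomial (Fin n) F, g.IsHomogeneous d →
          (∃ x, eval x g ≠ 0) → w ≤ (Finset.univ.filter fun x => eval x g ≠ 0).card) →
          Fintype.card F * w ≤ (Finset.univ.filter fun x => eval x f ≠ 0).card := by
        intro w hw
        refine card_mul_le_of_forall_hyperplane (by omega) _ ?_ fun a ha => ?_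
        · have := eval_smul_of_isHomogeneous hf 0 0
          rw [smul_zero, zero_pow (by omega), zero_mul] at this
          simpa using this
        · obtain ⟨K, hK, hKr⟩ := exists_linearMap_range_eq_hyperplane a ha
          obtain ⟨x, hx, hx0⟩ := h a ha
          obtain ⟨y, rfl⟩ := (hKr x).mp hx
          have hev : ∀ y, eval y (bind₁ (fun i =>
              ∑ j, C (K (fun l => if j = l then 1 else 0) i) * X j) f) = eval (K y) f := by
            intro y
            simpa using eval_bind₁_linear K 0 f y
          refine (hw (bind₁ (fun i => ∑ j, C (K (fun l => if j = l then 1 else 0) i) * X j) f)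
            ?_ ⟨y, by rwa [hev]⟩).trans ?_
          · rw [← one_mul d]
            exact hf.aeval (fun i => ∑ j, C (K (fun l => if j = l then 1 else 0) i) * X j)
              fun i => isHomogeneous_linear fun j => K (fun l => if j = l then 1 else 0) i
          · refine Finset.card_le_card_of_injOn K ?_ hK.injOn
            intro z hz
            simp only [Finset.coe_filter, Finset.mem_univ, true_and, Set.mem_ofPred_eq, hev] at hz
            simp only [Finset.coe_filter, Finset.mem_filter, Finset.mem_univ, true_and,
              Set.mem_ofPred_eq]
            exact ⟨hz, (hKr _).mpr ⟨z, rfl⟩⟩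
      by_cases hrn : r + 2 ≤ n
      · refine le_trans (le_of_eq ?_) (hrestrict _ fun g hg hg0 => ih g hrn hg hg0)
        rw [show n + 1 - r - 2 = n - r - 2 + 1 by omega, pow_succ]
        ring
      · refine le_trans ?_ (hrestrict _ fun g hg hg0 =>
          card_sub_one_le_of_isHomogeneous hg hd1 hg0)
        rw [show n + 1 - r - 2 = 0 by omega, pow_zero, mul_one, mul_comm]
        exact Nat.mul_le_mul_right _ (Nat.sub_le _ _)

lemma prod_card_fin {r t A B q : ℕ} {m : ℕ} (hm : m = r + 2 + t) :
    ∏ i : Fin m, (if i.val = 0 then A else if i.val ≤ r then 1 else if i.val = r + 1 then B else q)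
      = A * B * q ^ t := by
  subst hm
  rw [Fin.prod_univ_eq_prod_range
    (fun i => if i = 0 then A else if i ≤ r then 1 else if i = r + 1 then B else q) (r + 2 + t),
    Finset.prod_range_add, Finset.prod_range_succ, Finset.prod_range_succ']
  congr 1
  · congr 1
    · rw [Finset.prod_eq_one, one_mul, if_pos rfl]
      intro i hi
      rw [Finset.mem_range] at hi
      rw [if_neg (by omega), if_pos (by omega)]
    · rw [if_neg (by omega), if_neg (by omega), if_pos rfl]
  · rw [Finset.prod_congr rfl (g := fun _ => q), Finset.prod_const, Finset.card_range]
    intro i _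
    rw [if_neg (by omega), if_neg (by omega), if_neg (by omega)]

lemma exists_isHomogeneous_card_eval_ne_zero_le [Fintype F] [DecidableEq F] {m r s : ℕ}
    (hm : r + 2 ≤ m) (hs : s < Fintype.card F) :
    ∃ f : MvPolynomial (Fin m) F, f.IsHomogeneous (r * (Fintype.card F - 1) + s + 1) ∧
      (∃ x, eval x f ≠ 0) ∧ (Finset.univ.filter fun x => eval x f ≠ 0).card ≤
        (Fintype.card F - 1) * (Fintype.card F - s) * Fintype.card F ^ (m - r - 2) := by
  set q := Fintype.card F with hq
  have hq1 : 1 < q := Fintype.one_lt_card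
  obtain ⟨S, hS⟩ : ∃ S : Finset F, S.card = s := by
    obtain ⟨S, -, hS⟩ := Finset.exists_subset_card_eq
      (s := (Finset.univ : Finset F)) (n := s) (by rw [Finset.card_univ]; omega)
    exact ⟨S, hS⟩
  let i0 : Fin m := ⟨0, by omega⟩
  let j : Fin m := ⟨r + 1, by omega⟩
  let e : Fin r → Fin m := fun i => ⟨i.val + 1, by omega⟩
  let f : MvPolynomial (Fin m) F := (∏ i : Fin r, (X i0 ^ (q - 1) - X (e i) ^ (q - 1))) *
    (∏ c ∈ S, (X j - C c * X i0)) * X i0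
  have hev : ∀ x, eval x f = (∏ i : Fin r, (x i0 ^ (q - 1) - x (e i) ^ (q - 1))) *
      (∏ c ∈ S, (x j - c * x i0)) * x i0 := by
    intro x
    simp [f]
  refine ⟨f, ?_, ?_, ?_⟩
  · refine IsHomogeneous.mul (IsHomogeneous.mul ?_ ?_) (isHomogeneous_X _ _)
    · have := IsHomogeneous.prod Finset.univ
        (fun i : Fin r => (X i0 ^ (q - 1) - X (e i) ^ (q - 1) : MvPolynomial (Fin m) F))
        (fun _ => q - 1) fun i _ => (isHomogeneous_X_pow _ _).sub (isHomogeneous_X_pow _ _)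
      simpa using this
    · have := IsHomogeneous.prod S
        (fun c => (X j - C c * X i0 : MvPolynomial (Fin m) F))
        (fun _ => 1) fun c _ => (isHomogeneous_X _ _).sub (isHomogeneous_C_mul_X _ _)
      simpa [hS] using this
  · obtain ⟨b, hb⟩ : ∃ b, b ∉ S := by
      by_contra! h
      rw [Finset.eq_univ_of_forall h, Finset.card_univ] at hS
      omega
    refine ⟨fun i => if i.val = 0 then 1 else if i.val = r + 1 then b else 0, ?_⟩
    rw [hev]
    refine mul_ne_zero (mul_ne_zero ?_ ?_) (by simp [i0])
    · refine Finset.prod_ne_zero_iff.mpr fun i _ => ?_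
      have h1 : i.val ≠ r := i.isLt.ne
      have h2 : q - 1 ≠ 0 := by omega
      simp [i0, e, h1, h2]
    · refine Finset.prod_ne_zero_iff.mpr fun c hc => ?_
      simp only [i0, j, if_true, mul_one, Nat.add_eq_zero_iff, one_ne_zero, and_false, if_false]
      rw [sub_ne_zero]
      rintro rfl
      exact hb hc
  · let T : Fin m → Finset F := fun i => if i.val = 0 then Finset.univ.erase 0 else
      if i.val ≤ r then {0} else if i.val = r + 1 then Sᶜ else Finset.univ
    have hT : (Fintype.piFinset T).card = (q - 1) * (q - s) * q ^ (m - r - 2) := by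
      rw [Fintype.card_piFinset, ← prod_card_fin (r := r) (m := m) (by omega)]
      refine Finset.prod_congr rfl fun i _ => ?_
      simp only [T]
      split_ifs
      · rw [Finset.card_erase_of_mem (Finset.mem_univ _), Finset.card_univ]
      · simp
      · rw [Finset.card_compl, hS]
      · rw [Finset.card_univ]
    rw [← hT]
    refine Finset.card_le_card_of_injOn
      (fun x i => if i.val = 0 then x i else (x i0)⁻¹ * x i) ?_ ?_
    · intro x hx
      have hx' : eval x f ≠ 0 := by simpa using hx
      rw [hev] at hx'
      have h0 : x i0 ≠ 0 := right_ne_zero_of_mul hx'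
      have h1 := Finset.prod_ne_zero_iff.mp (left_ne_zero_of_mul (left_ne_zero_of_mul hx'))
      have h2 := Finset.prod_ne_zero_iff.mp (right_ne_zero_of_mul (left_ne_zero_of_mul hx'))
      rw [Finset.mem_coe, Fintype.mem_piFinset]
      intro i
      simp only [T]
      split_ifs with hi hir hi'
      · rw [show i = i0 from Fin.ext hi]
        simpa using h0
      · have h3 := h1 ⟨i.val - 1, by omega⟩ (Finset.mem_univ _)
        rw [show e ⟨i.val - 1, by omega⟩ = i from Fin.ext (by simp only [e]; omega)] at h3
        rw [Finset.mem_singleton]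
        by_contra h4
        rw [hq, FiniteField.pow_card_sub_one_eq_one _ h0,
          FiniteField.pow_card_sub_one_eq_one _ (right_ne_zero_of_mul h4), sub_self] at h3
        exact h3 rfl
      · rw [show i = j from Fin.ext hi', Finset.mem_compl]
        intro h3
        refine h2 _ h3 ?_
        field_simp
        ring
      · exact Finset.mem_univ _
    · intro x hx y hy hxy
      have hx' : eval x f ≠ 0 := by simpa using hx
      rw [hev] at hx'
      have h0 : x i0 ≠ 0 := right_ne_zero_of_mul hx'
      have h1 : x i0 = y i0 := by simpa [i0] using congrFun hxy i0
      funext i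
      have h2 := congrFun hxy i
      by_cases hi : i.val = 0
      · simpa [hi] using h2
      · simp only [hi, if_false, ← h1] at h2
        exact mul_left_cancel₀ (inv_ne_zero h0) h2

lemma mem_HRMC_iff [Fintype F] {m d : ℕ} {v : (Fin m → F) → F} :
    v ∈ HRMC F m d ↔
      ∃ f : MvPolynomial (Fin m) F, f.IsHomogeneous d ∧ v = fun P => eval P f := by
  refine ⟨fun h => ?_, fun h => Submodule.subset_span h⟩
  refine Submodule.span_induction (fun v hv => hv) ⟨0, isHomogeneous_zero _ _ _, by ext; simp⟩
    ?_ ?_ h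
  · rintro _ _ - - ⟨f, hf, rfl⟩ ⟨g, hg, rfl⟩
    exact ⟨f + g, hf.add hg, by ext; simp⟩
  · rintro c _ - ⟨f, hf, rfl⟩
    exact ⟨C c * f, hf.C_mul c, by ext; simp⟩

end

/-- minimum distance of the homogeneous Reed–Muller code: writing
`d - 1 = r(q-1) + s` with `0 ≤ s < q-1`, the minimum Hamming weight of a nonzero
codeword of `HRMC_d(m,q)` is `(q-1)(q-s)q^{m-r-2}`. -/
theorem hrmc_min_weight (q m d r s : ℕ) (F : Type*) [Field F] [Fintype F] [DecidableEq F]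
    (hq : Fintype.card F = q) (hm : 2 ≤ m) (hd1 : 1 ≤ d) (hd2 : d ≤ (m - 1) * (q - 1))
    (hrs : d - 1 = r * (q - 1) + s) (hs : s < q - 1) :
    IsLeast {n : ℕ | ∃ v ∈ HRMC F m d, v ≠ 0 ∧ hammingNorm v = n}
      ((q - 1) * (q - s) * q ^ (m - r - 2)) := by
  subst hq
  have hrm : r + 2 ≤ m := by
    by_contra! h
    have h1 : (m - 1) * (Fintype.card F - 1) ≤ r * (Fintype.card F - 1) :=
      Nat.mul_le_mul_right _ (by omega)
    omega
  have hd : d = r * (Fintype.card F - 1) + s + 1 := by omega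
  have hlow : ∀ f : MvPolynomial (Fin m) F, f.IsHomogeneous d → (∃ x, eval x f ≠ 0) →
      (Fintype.card F - 1) * (Fintype.card F - s) * Fintype.card F ^ (m - r - 2) ≤
        (Finset.univ.filter fun x => eval x f ≠ 0).card := fun f hf hf0 =>
    card_eval_ne_zero_ge_of_isHomogeneous hd1 hs.le hd.le m f hrm hf hf0
  constructor
  · obtain ⟨f, hf, ⟨x, hx⟩, hle⟩ := exists_isHomogeneous_card_eval_ne_zero_le
      (F := F) (s := s) hrm (by omega)
    rw [← hd] at hf
    exact ⟨_, mem_HRMC_iff.mpr ⟨f, hf, rfl⟩, fun h => hx (congrFun h x),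
      le_antisymm hle (hlow f hf ⟨x, hx⟩)⟩
  · rintro _ ⟨v, hv, hv0, rfl⟩
    obtain ⟨f, hf, rfl⟩ := mem_HRMC_iff.mp hv
    exact hlow f hf (Function.ne_iff.mp hv0)
end
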